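/- arXiv:2004.01103 — 5 statements merged into one kernel-verified Lean document; each statement's English description precedes it below -/
import Mathlib

section
/- There is an absolute constant C > 0 such that for all positive integers k and m with k ≤ 2^m, there exist positive integers p, q with p ≤ C·k²·m and q ≤ C·k²·m, matrices E ∈ ℝ^{p×m} and F ∈ ℝ^{p×q}, and a vector g ∈ ℝ^p, such that the projection onto the y-coordinates of the set {(y, w) ∈ ℝ^m × ℝ^q : E y + F w = g, w ≥ 0} equals the convex hull of Y_{k,m}. -/
/-- `Y k m` is the set of all sums of `k` pairwise distinct vectors in `{0,1}^m`,
viewed inside `ℝ^m`. -/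
def Y (k m : ℕ) : Set (Fin m → ℝ) :=
  {y | ∃ S : Finset (Fin m → ℝ), S.card = k ∧
    (∀ z ∈ S, ∀ i, z i = 0 ∨ z i = 1) ∧ y = ∑ z ∈ S, z}

namespace ExtendedFormulation

open Finset

/-- The `n`-th standard basis vector, or `0` if `m ≤ n`. -/
def basisVec (m n : ℕ) : Fin m → ℝ := fun t => if (t : ℕ) = n then 1 else 0

/-- The sums of `a` distinct `0/1`-vectors supported on the first `n` coordinates, described by
splitting each block of vectors according to its last free coordinate. -/
def blockSums (m : ℕ) : ℕ → ℕ → Set (Fin m → ℝ)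
  | 0, a => {y | a ≤ 1 ∧ y = 0}
  | n + 1, a => {y | ∃ c d : ℕ, c + d = a ∧ ∃ u ∈ blockSums m n c, ∃ v ∈ blockSums m n d,
      y = u + v + (d : ℝ) • basisVec m n}

/-- Zero-one vectors supported on the first `n` coordinates. -/
def IsZeroOneBelow {m : ℕ} (n : ℕ) (z : Fin m → ℝ) : Prop :=
  ∀ i, (z i = 0 ∨ z i = 1) ∧ (n ≤ (i : ℕ) → z i = 0)

theorem exists_finset_of_mem_blockSums {m n a : ℕ} (hn : n ≤ m) {y : Fin m → ℝ}
    (hy : y ∈ blockSums m n a) :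
    ∃ S : Finset (Fin m → ℝ), S.card = a ∧ (∀ z ∈ S, IsZeroOneBelow n z) ∧ y = ∑ z ∈ S, z := by
  classical
  induction n generalizing a y with
  | zero =>
    obtain ⟨ha, rfl⟩ := hy
    interval_cases a
    · exact ⟨∅, by simp⟩
    · exact ⟨{0}, by simp [IsZeroOneBelow]⟩
  | succ n ih =>
    obtain ⟨c, d, rfl, u, hu, v, hv, rfl⟩ := hy
    obtain ⟨S, rfl, hS, rfl⟩ := ih (by omega) hu
    obtain ⟨T, rfl, hT, rfl⟩ := ih (by omega) hv
    have hinj : Function.Injective (fun z : Fin m → ℝ => z + basisVec m n) :=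
      add_left_injective _
    have hdisj : Disjoint S (T.image fun z => z + basisVec m n) := by
      rw [Finset.disjoint_left]
      intro z hz hz'
      obtain ⟨x, hx, rfl⟩ := Finset.mem_image.1 hz'
      have h1 := (hS _ hz ⟨n, hn⟩).2 le_rfl
      have h2 := (hT _ hx ⟨n, hn⟩).2 le_rfl
      simp [basisVec, h2] at h1
    refine ⟨S ∪ T.image fun z => z + basisVec m n, ?_, ?_, ?_⟩
    · rw [card_union_of_disjoint hdisj, card_image_of_injective _ hinj]
    · intro z hz i
      rcases Finset.mem_union.1 hz with hz | hz
      · exact ⟨(hS z hz i).1, fun h => (hS z hz i).2 (by omega)⟩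
      · obtain ⟨x, hx, rfl⟩ := Finset.mem_image.1 hz
        have := hT x hx i
        by_cases hi : (i : ℕ) = n
        · have h0 := this.2 hi.ge
          exact ⟨by simp [basisVec, hi, h0], fun h => by omega⟩
        · refine ⟨by simpa [basisVec, hi] using this.1, fun h => ?_⟩
          simpa [basisVec, hi] using this.2 (by omega)
    · rw [sum_union hdisj, sum_image (fun _ _ _ _ h => hinj h), sum_add_distrib, sum_const,
        Nat.cast_smul_eq_nsmul, add_assoc]

theorem sum_mem_blockSums {m n : ℕ} (hn : n ≤ m) (S : Finset (Fin m → ℝ))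
    (hS : ∀ z ∈ S, IsZeroOneBelow n z) : ∑ z ∈ S, z ∈ blockSums m n S.card := by
  classical
  induction n generalizing S with
  | zero =>
    have h0 : ∀ z ∈ S, z = 0 := fun z hz => funext fun i => (hS z hz i).2 (Nat.zero_le _)
    refine ⟨card_le_one.2 fun x hx y hy => (h0 x hx).trans (h0 y hy).symm, ?_⟩
    exact sum_eq_zero h0
  | succ n ih =>
    set S₀ := S.filter fun z => z ⟨n, hn⟩ = 0 with hS₀
    set S₁ := S.filter fun z => ¬ z ⟨n, hn⟩ = 0 with hS₁
    have hinj : Function.Injective (fun z : Fin m → ℝ => z - basisVec m n) :=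
      sub_left_injective
    have hmem₀ := ih (by omega) S₀ (by
      intro z hz i
      obtain ⟨hz, h0⟩ := Finset.mem_filter.1 hz
      refine ⟨(hS z hz i).1, fun h => ?_⟩
      by_cases hi : (i : ℕ) = n
      · rwa [show i = ⟨n, hn⟩ from Fin.ext hi]
      · exact (hS z hz i).2 (by omega))
    have hmem₁ := ih (by omega) (S₁.image fun z => z - basisVec m n) (by
      intro z hz i
      obtain ⟨x, hx, rfl⟩ := Finset.mem_image.1 hz
      obtain ⟨hx, h1⟩ := Finset.mem_filter.1 hx
      by_cases hi : (i : ℕ) = n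
      · have h1 : x i = 1 := by
          rw [show i = ⟨n, hn⟩ from Fin.ext hi]
          exact (hS x hx ⟨n, hn⟩).1.resolve_left h1
        simp [basisVec, hi, h1]
      · refine ⟨by simpa [basisVec, hi] using (hS x hx i).1, fun h => ?_⟩
        simpa [basisVec, hi] using (hS x hx i).2 (by omega))
    rw [card_image_of_injective _ hinj] at hmem₁
    refine ⟨_, _, ?_, _, hmem₀, _, hmem₁, ?_⟩
    · exact card_filter_add_card_filter_not _
    · rw [sum_image (fun _ _ _ _ h => hinj h), sum_sub_distrib, sum_const,
        Nat.cast_smul_eq_nsmul, add_assoc, sub_add_cancel]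
      exact (sum_filter_add_sum_filter_not _ _ _).symm

theorem Y_eq_blockSums (k m : ℕ) : Y k m = blockSums m m k := by
  ext y
  constructor
  · rintro ⟨S, rfl, hS, rfl⟩
    exact sum_mem_blockSums le_rfl S fun z hz i => ⟨hS z hz i, fun h => by omega⟩
  · intro hy
    obtain ⟨S, hc, hS, rfl⟩ := exists_finset_of_mem_blockSums le_rfl hy
    exact ⟨S, hc, fun z hz i => (hS z hz i).1, rfl⟩

/-- The admissible triples `(n, c, d)`: at coordinate `n`, a block of `c + d` vectors is split
into `c` vectors with entry `0` and `d` vectors with entry `1`. -/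
def splits (k m : ℕ) : Finset (ℕ × ℕ × ℕ) :=
  (range m ×ˢ range (k + 1) ×ˢ range (k + 1)).filter fun q =>
    q.2.1 + q.2.2 ≤ k ∧ (q.1 = 0 → q.2.1 ≤ 1 ∧ q.2.2 ≤ 1)

theorem mem_splits {k m n c d : ℕ} : (n, c, d) ∈ splits k m ↔
    n < m ∧ c + d ≤ k ∧ (n = 0 → c ≤ 1 ∧ d ≤ 1) := by
  simp only [splits, mem_filter, mem_product, mem_range]
  omega

/-- Number of blocks of size `s` that the split `q` creates for coordinates below `n`. -/
def created (q : ℕ × ℕ × ℕ) (n s : ℕ) : ℝ :=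
  (if q.1 = n ∧ q.2.1 = s then 1 else 0) + (if q.1 = n ∧ q.2.2 = s then 1 else 0)

/-- Number of blocks of size `s` that the split `q` consumes at coordinate `n`. -/
def consumed (q : ℕ × ℕ × ℕ) (n s : ℕ) : ℝ :=
  if q.1 = n ∧ q.2.1 + q.2.2 = s then 1 else 0

/-- The number of entries `1` that the split `q` puts in coordinate `n`. -/
def ones (q : ℕ × ℕ × ℕ) (n : ℕ) : ℝ := if q.1 = n then (q.2.2 : ℝ) else 0

theorem exists_flow {k m n a : ℕ} (hn : n ≤ m) (ha : a ≤ k) {y : Fin m → ℝ}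
    (hy : y ∈ blockSums m n a) :
    ∃ w : splits k m → ℝ, (∀ q, 0 ≤ w q) ∧
      (∀ i s, ∑ q : splits k m, (consumed q i s - created q (i + 1) s) * w q =
        if i + 1 = n ∧ s = a then 1 else 0) ∧
      ∀ t : Fin m, ∑ q : splits k m, ones q t * w q = y t := by
  induction n generalizing a y with
  | zero =>
    obtain ⟨-, rfl⟩ := hy
    exact ⟨0, by simp⟩
  | succ n ih =>
    obtain ⟨c, d, rfl, u, hu, v, hv, rfl⟩ := hy
    obtain ⟨w₀, hw₀, hb₀, ho₀⟩ := ih (by omega) (by omega) hu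
    obtain ⟨w₁, hw₁, hb₁, ho₁⟩ := ih (by omega) (by omega) hv
    have hq : (n, c, d) ∈ splits k m := by
      refine mem_splits.2 ⟨hn, ha, ?_⟩
      rintro rfl
      exact ⟨hu.1, hv.1⟩
    refine ⟨w₀ + w₁ + Pi.single ⟨_, hq⟩ 1, ?_, ?_, ?_⟩
    · intro q
      have : (0 : ℝ) ≤ (Pi.single (⟨_, hq⟩ : splits k m) 1 : splits k m → ℝ) q := by
        rw [Pi.single_apply]; split_ifs <;> norm_num
      have := hw₀ q
      have := hw₁ q
      simp only [Pi.add_apply]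
      positivity
    · intro i s
      simp only [Pi.add_apply, mul_add, sum_add_distrib, hb₀, hb₁, Pi.single_apply, mul_ite,
        mul_one, mul_zero, sum_ite_eq', mem_univ, if_true]
      clear * -
      simp only [consumed, created]
      grind
    · intro t
      simp only [Pi.add_apply, mul_add, sum_add_distrib, ho₀, ho₁, Pi.single_apply, mul_ite,
        mul_one, mul_zero, sum_ite_eq', mem_univ, if_true, Pi.smul_apply, smul_eq_mul]
      clear * -
      simp only [ones, basisVec]
      grind

open Pointwise in
theorem add_mem_convexHull_blockSums {m n c d : ℕ} {u v : Fin m → ℝ}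
    (hu : u ∈ convexHull ℝ (blockSums m n c)) (hv : v ∈ convexHull ℝ (blockSums m n d)) :
    u + v + (d : ℝ) • basisVec m n ∈ convexHull ℝ (blockSums m (n + 1) (c + d)) := by
  have h : u + v + (d : ℝ) • basisVec m n ∈
      convexHull ℝ (blockSums m n c + blockSums m n d + {(d : ℝ) • basisVec m n}) := by
    rw [convexHull_add, convexHull_add, convexHull_singleton]
    exact Set.add_mem_add (Set.add_mem_add hu hv) rfl
  refine convexHull_mono ?_ h
  rintro _ ⟨_, ⟨u, hu, v, hv, rfl⟩, _, rfl, rfl⟩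
  exact ⟨c, d, rfl, u, hu, v, hv, rfl⟩

/-- A conic combination of members of a convex set is its total weight times a member. -/
theorem exists_smul_eq_sum {ι V : Type*} [AddCommGroup V] [Module ℝ V] {K : Set V}
    (hK : Convex ℝ K) (t : Finset ι) (w : ι → ℝ) (z : ι → V) (hw : ∀ i ∈ t, 0 ≤ w i)
    (hz : ∀ i ∈ t, w i ≠ 0 → z i ∈ K) :
    ∃ x : V, (∑ i ∈ t, w i ≠ 0 → x ∈ K) ∧ ∑ i ∈ t, w i • z i = (∑ i ∈ t, w i) • x := by
  by_cases h : ∑ i ∈ t, w i = 0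
  · refine ⟨0, fun h' => absurd h h', ?_⟩
    rw [smul_zero]
    refine sum_eq_zero fun i hi => ?_
    rw [(sum_eq_zero_iff_of_nonneg hw).1 h i hi, zero_smul]
  · refine ⟨t.centerMass w z, fun _ => ?_, ?_⟩
    · rw [← centerMass_filter_ne_zero]
      refine hK.centerMass_mem (fun i hi => hw i (mem_filter.1 hi).1) ?_
        fun i hi => hz i (mem_filter.1 hi).1 (mem_filter.1 hi).2
      rw [sum_filter_ne_zero]
      exact (sum_nonneg hw).lt_of_ne' h
    · rw [centerMass, smul_smul, mul_inv_cancel₀ h, one_smul]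

/-- The weight of blocks of size `s` entering level `n` of a flow `w`. -/
def inflow {k m : ℕ} (w : splits k m → ℝ) (n s : ℕ) : ℝ :=
  ∑ q : splits k m, created q n s * w q + if n = m ∧ s = k then 1 else 0

theorem sum_inflow_smul {k m n : ℕ} (w : splits k m → ℝ) (hn : n < m) (p : ℕ → Fin m → ℝ) :
    ∑ s ∈ range (k + 1), inflow w n s • p s =
      ∑ q : splits k m, if q.1.1 = n then w q • (p q.1.2.1 + p q.1.2.2) else 0 := by
  have h (s : ℕ) : inflow w n s • p s = ∑ q : splits k m, if q.1.1 = n then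
      ((if q.1.2.1 = s then w q • p s else 0) + (if q.1.2.2 = s then w q • p s else 0))
      else 0 := by
    rw [inflow, if_neg (by omega), add_zero, sum_smul]
    refine sum_congr rfl fun q _ => ?_
    by_cases hq : q.1.1 = n
    · simp only [created, hq, true_and, if_true, add_mul, add_smul, ite_mul, one_mul, zero_mul,
        ite_smul, zero_smul]
    · simp only [created, hq, false_and, if_false, add_zero, zero_mul, zero_smul]
  rw [sum_congr rfl fun s _ => h s, sum_comm]
  refine sum_congr rfl fun q _ => ?_
  have hq : q.1.1 < m ∧ q.1.2.1 + q.1.2.2 ≤ k ∧ _ := mem_splits.1 q.2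
  have hc : q.1.2.1 ∈ range (k + 1) := mem_range.2 (by omega)
  have hd : q.1.2.2 ∈ range (k + 1) := mem_range.2 (by omega)
  split_ifs
  · rw [sum_add_distrib, sum_ite_eq, sum_ite_eq, if_pos hc, if_pos hd, smul_add]
  · exact sum_const_zero

theorem exists_decomposition {k m : ℕ} (hm : 0 < m) (w : splits k m → ℝ) (hw : ∀ q, 0 ≤ w q)
    (hb : ∀ i < m, ∀ s ≤ k, ∑ q : splits k m, (consumed q i s - created q (i + 1) s) * w q =
      if i + 1 = m ∧ s = k then 1 else 0) (n : ℕ) (hn : n ≤ m) :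
    ∃ p : ℕ → Fin m → ℝ, (∀ s, inflow w n s ≠ 0 → p s ∈ convexHull ℝ (blockSums m n s)) ∧
      ∑ q : splits k m, (if q.1.1 < n then w q • (q.1.2.2 : ℝ) • basisVec m q.1.1 else 0) =
        ∑ s ∈ range (k + 1), inflow w n s • p s := by
  have hq (q : splits k m) : q.1.1 < m ∧ q.1.2.1 + q.1.2.2 ≤ k ∧
      (q.1.1 = 0 → q.1.2.1 ≤ 1 ∧ q.1.2.2 ≤ 1) := mem_splits.1 q.2
  induction n with
  | zero =>
    refine ⟨0, fun s hs => subset_convexHull ℝ _ ⟨?_, rfl⟩, by simp⟩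
    by_contra hs'
    refine hs ?_
    rw [inflow, if_neg (by omega), add_zero]
    refine sum_eq_zero fun q _ => ?_
    have := hq q
    rw [created, if_neg (by omega), if_neg (by omega)]
    simp
  | succ n ih =>
    obtain ⟨p, hp, hsum⟩ := ih (by omega)
    have hin (s : ℕ) (hs : s ≤ k) : inflow w (n + 1) s =
        ∑ q : splits k m with q.1.1 = n ∧ q.1.2.1 + q.1.2.2 = s, w q := by
      have := hb n hn s hs
      simp only [sub_mul, sum_sub_distrib] at this
      rw [inflow, ← this, add_sub_cancel, sum_filter]
      exact sum_congr rfl fun q _ => by simp [consumed]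
    have hcreated (q : splits k m) (s : ℕ) : 0 ≤ created q n s * w q := by
      have := hw q
      unfold created
      positivity
    have hpos (q : splits k m) (hqn : q.1.1 = n) (hwq : w q ≠ 0) (s : ℕ)
        (hs : q.1.2.1 = s ∨ q.1.2.2 = s) : inflow w n s ≠ 0 := by
      have h1 : 0 < created q n s * w q := by
        refine mul_pos ?_ ((hw q).lt_of_ne' hwq)
        rcases hs with hs | hs <;> simp only [created, hqn, hs] <;> simp <;> positivity
      have h2 := single_le_sum (fun q _ => hcreated q s) (mem_univ q)
      have h3 : (0 : ℝ) ≤ if n = m ∧ s = k then 1 else 0 := by positivity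
      rw [inflow]
      linarith
    let z (q : splits k m) : Fin m → ℝ :=
      p q.1.2.1 + p q.1.2.2 + (q.1.2.2 : ℝ) • basisVec m n
    have key (s : ℕ) := exists_smul_eq_sum (convex_convexHull ℝ (blockSums m (n + 1) s))
      ({q : splits k m | q.1.1 = n ∧ q.1.2.1 + q.1.2.2 = s} : Finset _) w z
      (fun q _ => hw q) (by
        intro q hqs hwq
        obtain ⟨-, hqn, rfl⟩ := mem_filter.1 hqs
        exact add_mem_convexHull_blockSums (hp _ (hpos q hqn hwq _ (.inl rfl)))
          (hp _ (hpos q hqn hwq _ (.inr rfl))))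
    choose x hx hxsum using key
    refine ⟨x, fun s hs => ?_, ?_⟩
    · refine hx s ?_
      by_cases hsk : s ≤ k
      · rwa [← hin s hsk]
      · refine absurd ?_ hs
        rw [inflow, if_neg (by omega), add_zero]
        refine sum_eq_zero fun q _ => ?_
        have := hq q
        rw [created, if_neg (by omega), if_neg (by omega)]
        simp
    · have hrhs : ∑ s ∈ range (k + 1), inflow w (n + 1) s • x s =
          ∑ q : splits k m, if q.1.1 = n then w q • z q else 0 := by
        have (s) (hs : s ∈ range (k + 1)) : inflow w (n + 1) s • x s = ∑ q : splits k m,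
            if q.1.2.1 + q.1.2.2 = s then (if q.1.1 = n then w q • z q else 0) else 0 := by
          rw [hin s (by simpa [Nat.lt_succ_iff] using hs), ← hxsum, sum_filter]
          exact sum_congr rfl fun q _ => by grind
        rw [sum_congr rfl this, sum_comm]
        refine sum_congr rfl fun q _ => ?_
        rw [sum_ite_eq, if_pos (by have := hq q; simp; omega)]
      have hlhs := sum_inflow_smul w hn p
      rw [hrhs]
      rw [hlhs] at hsum
      calc _ = ∑ q : splits k m, ((if q.1.1 < n then
              w q • (q.1.2.2 : ℝ) • basisVec m q.1.1 else 0) +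
            if q.1.1 = n then w q • (q.1.2.2 : ℝ) • basisVec m n else 0) := by
            refine sum_congr rfl fun q _ => ?_
            rcases lt_trichotomy q.1.1 n with h | h | h
            · simp [h, h.ne, h.trans n.lt_succ_self]
            · simp [h]
            · simp [h.ne', h.not_gt, show ¬ q.1.1 < n + 1 by omega]
        _ = _ := by
            rw [sum_add_distrib, hsum, ← sum_add_distrib]
            refine sum_congr rfl fun q _ => ?_
            split_ifs
            · rw [← smul_add]
            · simp

theorem mem_convexHull_of_flow {k m : ℕ} (hm : 0 < m) (w : splits k m → ℝ) (hw : ∀ q, 0 ≤ w q)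
    (hb : ∀ i < m, ∀ s ≤ k, ∑ q : splits k m, (consumed q i s - created q (i + 1) s) * w q =
      if i + 1 = m ∧ s = k then 1 else 0) (y : Fin m → ℝ)
    (hy : ∀ t : Fin m, ∑ q : splits k m, ones q t * w q = y t) :
    y ∈ convexHull ℝ (blockSums m m k) := by
  obtain ⟨p, hp, hsum⟩ := exists_decomposition hm w hw hb m le_rfl
  have hq (q : splits k m) : q.1.1 < m := (mem_splits.1 q.2).1
  have hin (s : ℕ) : inflow w m s = if s = k then 1 else 0 := by
    have : ∑ q : splits k m, created q m s * w q = 0 := sum_eq_zero fun q _ => by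
      have := hq q
      rw [created, if_neg (by omega), if_neg (by omega)]
      simp
    rw [inflow, this, zero_add]
    simp only [true_and]
  have hyp : y = p k := by
    simp only [hin, ite_smul, one_smul, zero_smul, sum_ite_eq', mem_range, Nat.lt_succ_self,
      if_true, hq] at hsum
    rw [← hsum]
    ext t
    rw [← hy t, Finset.sum_apply]
    refine sum_congr rfl fun q _ => ?_
    simp only [ones, basisVec, Pi.smul_apply, smul_eq_mul, eq_comm (a := (t : ℕ))]
    split_ifs <;> ring
  rw [hyp]
  exact hp k (by simp [hin])

/-- A system `E y + F w = g`, `w ≥ 0` with arbitrary finite index types whose projection contains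
`A` and lies in the convex hull of `A` yields such a system indexed by `Fin p`, `Fin q`. -/
theorem exists_fin_system {P Q M : Type*} [Fintype P] [Fintype Q] [Fintype M]
    (A : Set (M → ℝ)) (E : Matrix P M ℝ) (F : Matrix P Q ℝ) (g : P → ℝ)
    (h₁ : ∀ y ∈ A, ∃ w : Q → ℝ, (∀ j, 0 ≤ w j) ∧ E.mulVec y + F.mulVec w = g)
    (h₂ : ∀ y, ∀ w : Q → ℝ, (∀ j, 0 ≤ w j) → E.mulVec y + F.mulVec w = g →
      y ∈ convexHull ℝ A) :
    ∃ (E' : Matrix (Fin (Fintype.card P)) M ℝ)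
      (F' : Matrix (Fin (Fintype.card P)) (Fin (Fintype.card Q)) ℝ)
      (g' : Fin (Fintype.card P) → ℝ),
      {y : M → ℝ | ∃ w : Fin (Fintype.card Q) → ℝ,
        (∀ j, 0 ≤ w j) ∧ E'.mulVec y + F'.mulVec w = g'} = convexHull ℝ A := by
  let eP := (Fintype.equivFin P).symm
  let eQ := (Fintype.equivFin Q).symm
  have hiff (y : M → ℝ) (w : Fin (Fintype.card Q) → ℝ) :
      (E.submatrix eP id).mulVec y + (F.submatrix eP eQ).mulVec w = g ∘ eP ↔
        E.mulVec y + F.mulVec (w ∘ eQ.symm) = g := by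
    rw [Matrix.submatrix_mulVec_equiv]
    exact eP.surjective.injective_comp_right.eq_iff
      (a := E.mulVec y + F.mulVec (w ∘ eQ.symm)) (b := g)
  refine ⟨E.submatrix eP id, F.submatrix eP eQ, g ∘ eP, ?_⟩
  simp only [hiff]
  refine Set.Subset.antisymm ?_ (convexHull_min ?_ ?_)
  · rintro y ⟨w, hw, h⟩
    exact h₂ y _ (fun j => hw _) h
  · intro y hy
    obtain ⟨w, hw, h⟩ := h₁ y hy
    refine ⟨w ∘ eQ, fun j => hw _, ?_⟩
    rwa [Function.comp_assoc, Equiv.self_comp_symm, Function.comp_id]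
  · rintro y ⟨w, hw, h⟩ y' ⟨w', hw', h'⟩ a b ha hb hab
    refine ⟨a • w + b • w', fun j => ?_, ?_⟩
    · have := hw j
      have := hw' j
      simp only [Pi.add_apply, Pi.smul_apply, smul_eq_mul]
      positivity
    · have : (a • w + b • w') ∘ eQ.symm = a • (w ∘ eQ.symm) + b • (w' ∘ eQ.symm) := rfl
      rw [this]
      simp only [Matrix.mulVec_add, Matrix.mulVec_smul]
      rw [add_add_add_comm, ← smul_add, ← smul_add, h, h', ← add_smul, hab, one_smul]

end ExtendedFormulation

open ExtendedFormulation in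
/-- There is an absolute constant `C > 0` such that for all positive `k, m` with
`k ≤ 2^m` there is an extended formulation `{(y,w) : E y + F w = g, w ≥ 0}` with
`O(k² m)` variables and constraints whose projection onto the `y`-space is
`conv(Y_{k,m})`. -/
theorem extended_formulation_Y :
    ∃ C : ℝ, 0 < C ∧
      ∀ k m : ℕ, 0 < k → 0 < m → k ≤ 2 ^ m →
        ∃ p q : ℕ, 0 < p ∧ 0 < q ∧
          (p : ℝ) ≤ C * k ^ 2 * m ∧ (q : ℝ) ≤ C * k ^ 2 * m ∧
          ∃ (E : Matrix (Fin p) (Fin m) ℝ) (F : Matrix (Fin p) (Fin q) ℝ)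
            (g : Fin p → ℝ),
            {y : Fin m → ℝ | ∃ w : Fin q → ℝ,
                (∀ j, 0 ≤ w j) ∧ E.mulVec y + F.mulVec w = g}
              = convexHull ℝ (Y k m) := by
  refine ⟨4, by norm_num, fun k m hk hm _ => ?_⟩
  let E : Matrix (Fin m ⊕ Fin m × Fin (k + 1)) (Fin m) ℝ :=
    Matrix.of (Sum.elim (fun t => -(1 : Matrix (Fin m) (Fin m) ℝ) t) fun _ => 0)
  let F : Matrix (Fin m ⊕ Fin m × Fin (k + 1)) (splits k m) ℝ :=
    Matrix.of (Sum.elim (fun t q => ones q t)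
      fun r q => consumed q r.1 r.2 - created q (r.1 + 1) r.2)
  let g : Fin m ⊕ Fin m × Fin (k + 1) → ℝ :=
    Sum.elim 0 fun r => if (r.1 : ℕ) + 1 = m ∧ (r.2 : ℕ) = k then 1 else 0
  have hsys (y : Fin m → ℝ) (w : splits k m → ℝ) : E.mulVec y + F.mulVec w = g ↔
      (∀ i < m, ∀ s ≤ k, ∑ q : splits k m, (consumed q i s - created q (i + 1) s) * w q =
        if i + 1 = m ∧ s = k then 1 else 0) ∧ ∀ t : Fin m, ∑ q : splits k m, ones q t * w q = y t := by
    have hl (t : Fin m) : (E.mulVec y + F.mulVec w) (.inl t) =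
        -y t + ∑ q : splits k m, ones q t * w q := by
      simp [E, F, Matrix.mulVec, dotProduct, Matrix.one_apply]
    have hr (r : Fin m × Fin (k + 1)) : (E.mulVec y + F.mulVec w) (.inr r) =
        ∑ q : splits k m, (consumed q r.1 r.2 - created q (r.1 + 1) r.2) * w q := by
      simp [E, F, Matrix.mulVec, dotProduct]
    rw [funext_iff, Sum.forall, and_comm]
    simp only [hl, hr]
    refine and_congr ⟨fun h i hi s hs => h (⟨i, hi⟩, ⟨s, Nat.lt_succ_of_le hs⟩),
      fun h r => h r.1 r.1.2 r.2 (Nat.le_of_lt_succ r.2.2)⟩ (forall_congr' fun t => ?_)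
    rw [neg_add_eq_iff_eq_add]
    simp [g]
  have hcardP : Fintype.card (Fin m ⊕ Fin m × Fin (k + 1)) = m + m * (k + 1) := by simp
  have hcardQ : Fintype.card (splits k m) ≤ m * ((k + 1) * (k + 1)) := by
    rw [Fintype.card_coe]
    exact (Finset.card_filter_le _ _).trans (by simp)
  have hk' : (1 : ℝ) ≤ k := by exact_mod_cast hk
  have hm' : (0 : ℝ) < m := by exact_mod_cast hm
  refine ⟨Fintype.card (Fin m ⊕ Fin m × Fin (k + 1)), Fintype.card (splits k m),
    by rw [hcardP]; omega, ?_, ?_, ?_,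
    exists_fin_system (Y k m) E F g (fun y hy => ?_) fun y w hw h => ?_⟩
  · exact Fintype.card_pos_iff.2 ⟨⟨(0, 0, 0), mem_splits.2 ⟨hm, by omega, by omega⟩⟩⟩
  · rw [hcardP]
    push_cast
    have : (k : ℝ) + 2 ≤ 4 * k ^ 2 := by nlinarith
    nlinarith
  · have h1 : (Fintype.card (splits k m) : ℝ) ≤ m * ((k + 1) * (k + 1)) := by
      exact_mod_cast hcardQ
    have : ((k : ℝ) + 1) * (k + 1) ≤ 4 * k ^ 2 := by nlinarith
    nlinarith
  · rw [Y_eq_blockSums] at hy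
    obtain ⟨w, hw, hb, ho⟩ := exists_flow le_rfl le_rfl hy
    exact ⟨w, hw, (hsys y w).2 ⟨fun i _ s _ => hb i s, ho⟩⟩
  · rw [Y_eq_blockSums]
    obtain ⟨hb, ho⟩ := (hsys y w).1 h
    exact mem_convexHull_of_flow hm w hw hb y ho
end

section
/- For all integers k ≥ 2 and m ≥ 2, the set Y_{k,m} equals the union of the following three sets: (i) {(0, ȳ) : ȳ ∈ Y_{k,m−1}}; (ii) {(k, ȳ) : ȳ ∈ Y_{k,m−1}}; (iii) the union over 1 ≤ l ≤ k−1 of {(k−l, y′ + y″) : y′ ∈ Y_{l,m−1}, y″ ∈ Y_{k−l,m−1}}, where (t, ȳ) denotes the vector in ℤ^m whose first coordinate is t and whose remaining coordinates are given by ȳ ∈ ℤ^{m−1}. -/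
open Classical in
theorem sum_image_cons {m : ℕ} (c : ℝ) (T : Finset (Fin m → ℝ)) :
    ∑ z ∈ T.image (Fin.cons (α := fun _ : Fin (m + 1) => ℝ) c), z =
      Fin.cons (T.card * c) (∑ z ∈ T, z) := by
  rw [Finset.sum_image (Fin.cons_right_injective (α := fun _ => ℝ) c).injOn]
  ext i
  refine Fin.cases ?_ (fun j => ?_) i <;> simp [Finset.sum_apply]

open Classical in
theorem image_cons_image_tail {m : ℕ} {c : ℝ} {S : Finset (Fin (m + 1) → ℝ)}
    (hS : ∀ z ∈ S, z 0 = c) :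
    (S.image Fin.tail).image (Fin.cons (α := fun _ : Fin (m + 1) => ℝ) c) = S := by
  rw [Finset.image_image]
  conv_rhs => rw [← Finset.image_id (s := S)]
  refine Finset.image_congr fun z hz => ?_
  simp only [Function.comp_apply, id, ← hS z hz]
  exact Fin.cons_self_tail z

/-- The sum of a set of `0/1` vectors with constant first coordinate `c` is an element of
`Y S.card m` preceded by `S.card * c`. -/
theorem exists_mem_Y_sum_eq_cons {m : ℕ} {c : ℝ} {S : Finset (Fin (m + 1) → ℝ)}
    (hS : ∀ z ∈ S, z 0 = c) (h01 : ∀ z ∈ S, ∀ i, z i = 0 ∨ z i = 1) :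
    ∃ y ∈ Y S.card m, ∑ z ∈ S, z = Fin.cons (S.card * c) y := by
  classical
  have hcard : (S.image Fin.tail).card = S.card := by
    conv_rhs => rw [← image_cons_image_tail hS]
    exact (Finset.card_image_of_injective _
      (Fin.cons_right_injective (α := fun _ => ℝ) c)).symm
  refine ⟨∑ z ∈ S.image Fin.tail, z, ⟨S.image Fin.tail, hcard, ?_, rfl⟩, ?_⟩
  · intro z hz i
    obtain ⟨w, hw, rfl⟩ := Finset.mem_image.1 hz
    exact h01 w hw i.succ
  · conv_lhs => rw [← image_cons_image_tail hS]
    rw [sum_image_cons, hcard]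

theorem cons_add_cons {m : ℕ} (a b : ℝ) (u v : Fin m → ℝ) :
    (Fin.cons a u + Fin.cons b v : Fin (m + 1) → ℝ) = Fin.cons (a + b) (u + v) := by
  ext i
  refine Fin.cases ?_ (fun j => ?_) i <;> simp

theorem mem_Y_succ_iff {k m : ℕ} {v : Fin (m + 1) → ℝ} :
    v ∈ Y k (m + 1) ↔ ∃ a b : ℕ, a + b = k ∧ ∃ y' ∈ Y a m, ∃ y'' ∈ Y b m,
      v = Fin.cons (b : ℝ) (y' + y'') := by
  classical
  constructor
  · rintro ⟨S, rfl, h01, rfl⟩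
    obtain ⟨y', hy', h'⟩ := exists_mem_Y_sum_eq_cons (c := 0) (S := S.filter (· 0 = 0))
      (fun z hz => (Finset.mem_filter.1 hz).2) (fun z hz => h01 z (Finset.mem_filter.1 hz).1)
    obtain ⟨y'', hy'', h''⟩ := exists_mem_Y_sum_eq_cons (c := 1) (S := S.filter (¬ · 0 = 0))
      (fun z hz => (h01 z (Finset.mem_filter.1 hz).1 0).resolve_left (Finset.mem_filter.1 hz).2)
      (fun z hz => h01 z (Finset.mem_filter.1 hz).1)
    refine ⟨_, _, Finset.card_filter_add_card_filter_not _, y', hy', y'', hy'', ?_⟩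
    rw [← Finset.sum_filter_add_sum_filter_not S (· 0 = 0), h', h'', cons_add_cons]
    simp
  · rintro ⟨a, b, rfl, _, ⟨A, rfl, hA, rfl⟩, _, ⟨B, rfl, hB, rfl⟩, rfl⟩
    have hdisj : Disjoint (A.image (Fin.cons (α := fun _ : Fin (m + 1) => ℝ) 0))
        (B.image (Fin.cons (α := fun _ : Fin (m + 1) => ℝ) 1)) := by
      rw [Finset.disjoint_left]
      intro z hz hz'
      obtain ⟨u, -, rfl⟩ := Finset.mem_image.1 hz
      obtain ⟨w, -, hw⟩ := Finset.mem_image.1 hz'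
      simpa using congrFun hw 0
    refine ⟨A.image (Fin.cons (α := fun _ : Fin (m + 1) => ℝ) 0) ∪
      B.image (Fin.cons (α := fun _ : Fin (m + 1) => ℝ) 1), ?_, ?_, ?_⟩
    · rw [Finset.card_union_of_disjoint hdisj,
        Finset.card_image_of_injective _ (Fin.cons_right_injective (α := fun _ => ℝ) 0),
        Finset.card_image_of_injective _ (Fin.cons_right_injective (α := fun _ => ℝ) 1)]
    · intro z hz i
      rcases Finset.mem_union.1 hz with h | h <;> obtain ⟨u, hu, rfl⟩ := Finset.mem_image.1 h <;>
        refine Fin.cases ?_ (fun j => ?_) i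
      · simp
      · simpa using hA u hu j
      · simp
      · simpa using hB u hu j
    · rw [Finset.sum_union hdisj, sum_image_cons, sum_image_cons, cons_add_cons]
      simp

theorem mem_Y_zero_iff {m : ℕ} {y : Fin m → ℝ} : y ∈ Y 0 m ↔ y = 0 := by
  constructor
  · rintro ⟨S, hS, -, rfl⟩
    simp [Finset.card_eq_zero.1 hS]
  · rintro rfl
    exact ⟨∅, by simp⟩

/-- Recursive decomposition of `Y_{k,m}` (with `k ≥ 2` and `m + 1 ≥ 2` coordinates):
`Y_{k,m}` is the union of `{(0, yb) : yb ∈ Y_{k,m-1}}`, `{(k, yb) : yb ∈ Y_{k,m-1}}`, and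
the sets `{(k - l, y' + y'') : y' ∈ Y_{l,m-1}, y'' ∈ Y_{k-l,m-1}}` for `1 ≤ l ≤ k - 1`. -/
theorem Y_decomposition (k m : ℕ) (hk : 2 ≤ k) (hm : 1 ≤ m) :
    Y k (m + 1) =
      {v | ∃ yb ∈ Y k m, v = Fin.cons (0 : ℝ) yb} ∪
      {v | ∃ yb ∈ Y k m, v = Fin.cons ((k : ℝ)) yb} ∪
      {v | ∃ l : ℕ, 1 ≤ l ∧ l ≤ k - 1 ∧
        ∃ y' ∈ Y l m, ∃ y'' ∈ Y (k - l) m,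
          v = Fin.cons (((k - l : ℕ) : ℝ)) (y' + y'')} := by
  ext v
  rw [mem_Y_succ_iff]
  constructor
  · rintro ⟨a, b, rfl, y', hy', y'', hy'', rfl⟩
    rcases Nat.eq_zero_or_pos b with rfl | hb
    · rw [mem_Y_zero_iff] at hy''
      exact Or.inl (Or.inl ⟨y', hy', by simp [hy'']⟩)
    rcases Nat.eq_zero_or_pos a with rfl | ha
    · rw [mem_Y_zero_iff] at hy'
      exact Or.inl (Or.inr ⟨y'', by simpa using hy'', by simp [hy']⟩)
    · exact Or.inr ⟨a, ha, by omega, y', hy', y'', by simpa using hy'', by simp⟩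
  · rintro ((⟨y, hy, rfl⟩ | ⟨y, hy, rfl⟩) | ⟨l, -, hl, y', hy', y'', hy'', rfl⟩)
    · exact ⟨k, 0, rfl, y, hy, 0, mem_Y_zero_iff.2 rfl, by simp⟩
    · exact ⟨0, k, Nat.zero_add k, 0, mem_Y_zero_iff.2 rfl, y, hy, by simp⟩
    · exact ⟨l, k - l, by omega, y', hy', y'', hy'', rfl⟩
end

section
/- Let k ≥ 2, m ≥ 2, and d ∈ ℝ^m, and write d′ := (d_2,…,d_m). For 1 ≤ i ≤ k define μ_i := inf{d′ ⋅ ȳ : ȳ ∈ Y_{i,m−1}} (with the convention that the infimum over the empty set is +∞). Then inf{d ⋅ y : y ∈ Y_{k,m}} = min{ μ_k, k·d_1 + μ_k, min_{1 ≤ l ≤ k−1} ( μ_l + (k−l)·d_1 + μ_{k−l} ) }, where the arithmetic is in ℝ ∪ {+∞}. -/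
/-- `mu m d i` is the infimum (in `ℝ ∪ {±∞}`, with value `+∞` on the empty set) of
`d' ⋅ y` over `y ∈ Y_{i,m}`, where `d' = (d_2, …, d_{m+1})`. -/
noncomputable def mu (m : ℕ) (d : Fin (m + 1) → ℝ) (i : ℕ) : EReal :=
  sInf ((fun y : Fin m → ℝ => ((∑ j, d j.succ * y j : ℝ) : EReal)) '' Y i m)

/-- `IsBinary S` says that all vectors in `S` have entries in `{0,1}`. -/
def IsBinary {m : ℕ} (S : Finset (Fin m → ℝ)) : Prop :=
  ∀ z ∈ S, ∀ i, z i = 0 ∨ z i = 1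

/-- The sum of `d ⋅ z` over the vectors `z ∈ S`. -/
noncomputable def totalCost {m : ℕ} (d : Fin m → ℝ) (S : Finset (Fin m → ℝ)) : ℝ :=
  ∑ z ∈ S, ∑ j, d j * z j

theorem sum_mul_sum_apply {m : ℕ} (d : Fin m → ℝ) (S : Finset (Fin m → ℝ)) :
    ∑ j, d j * (∑ z ∈ S, z) j = totalCost d S := by
  simp only [totalCost, Finset.sum_apply, Finset.mul_sum]
  exact Finset.sum_comm

theorem image_Y_eq (k m : ℕ) (d : Fin m → ℝ) :
    (fun y : Fin m → ℝ => ((∑ j, d j * y j : ℝ) : EReal)) '' Y k m =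
      (fun S => (totalCost d S : EReal)) '' {S | S.card = k ∧ IsBinary S} := by
  ext x
  constructor
  · rintro ⟨y, ⟨S, hc, hS, rfl⟩, rfl⟩
    exact ⟨S, ⟨hc, hS⟩, by simp only [sum_mul_sum_apply]⟩
  · rintro ⟨S, ⟨hc, hS⟩, rfl⟩
    exact ⟨_, ⟨S, hc, hS, rfl⟩, by simp only [sum_mul_sum_apply]⟩

theorem finite_isBinary (k m : ℕ) :
    {S : Finset (Fin m → ℝ) | S.card = k ∧ IsBinary S}.Finite := by
  have hC : (Set.univ.pi fun _ : Fin m => ({0, 1} : Set ℝ)).Finite :=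
    Set.Finite.pi fun _ => Set.toFinite _
  refine (hC.toFinset.powerset.finite_toSet).subset fun S hS => ?_
  simp only [Finset.coe_powerset, Set.mem_preimage, Set.mem_powerset_iff, Set.Finite.coe_toFinset]
  intro z hz i _
  simpa using hS.2 z hz i

theorem mu_le (m : ℕ) (d : Fin (m + 1) → ℝ) {i : ℕ} {S : Finset (Fin m → ℝ)}
    (hc : S.card = i) (hS : IsBinary S) :
    mu m d i ≤ (totalCost (fun j => d j.succ) S : EReal) := by
  rw [mu, image_Y_eq i m fun j => d j.succ]
  exact sInf_le ⟨S, ⟨hc, hS⟩, rfl⟩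

theorem mu_eq_top_or_attained (m : ℕ) (d : Fin (m + 1) → ℝ) (i : ℕ) :
    mu m d i = ⊤ ∨ ∃ S : Finset (Fin m → ℝ), S.card = i ∧ IsBinary S ∧
      mu m d i = (totalCost (fun j => d j.succ) S : EReal) := by
  rw [mu, image_Y_eq i m fun j => d j.succ]
  rcases Set.eq_empty_or_nonempty
    ((fun S => (totalCost (fun j => d j.succ) S : EReal)) ''
      {S : Finset (Fin m → ℝ) | S.card = i ∧ IsBinary S}) with h | h
  · left
    rw [h, sInf_empty]
  · right
    obtain ⟨S, ⟨hc, hS⟩, hv⟩ := h.csInf_mem ((finite_isBinary i m).image _)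
    exact ⟨S, hc, hS, hv.symm⟩

theorem mu_zero (m : ℕ) (d : Fin (m + 1) → ℝ) : mu m d 0 = 0 := by
  rw [mu, image_Y_eq 0 m fun j => d j.succ]
  have h : {S : Finset (Fin m → ℝ) | S.card = 0 ∧ IsBinary S} = {∅} := by
    ext S
    simp +contextual [IsBinary]
  rw [h]
  simp [totalCost]

theorem totalCost_map_cons {m : ℕ} (d : Fin (m + 1) → ℝ) (a : ℝ) (S : Finset (Fin m → ℝ)) :
    totalCost d (S.map ⟨_, Fin.cons_right_injective (α := fun _ => ℝ) a⟩) =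
      S.card * (d 0 * a) + totalCost (fun j => d j.succ) S := by
  simp [totalCost, Fin.sum_univ_succ, Finset.sum_add_distrib]

theorem exists_map_cons {m : ℕ} (a : ℝ) (S : Finset (Fin (m + 1) → ℝ)) (hS : IsBinary S)
    (ha : ∀ z ∈ S, z 0 = a) :
    ∃ T : Finset (Fin m → ℝ), IsBinary T ∧
      S = T.map ⟨_, Fin.cons_right_injective (α := fun _ => ℝ) a⟩ := by
  classical
  refine ⟨S.image Fin.tail, ?_, ?_⟩
  · intro z hz i
    obtain ⟨w, hw, rfl⟩ := Finset.mem_image.1 hz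
    exact hS w hw i.succ
  · ext z
    simp only [Finset.mem_map, Finset.mem_image, Function.Embedding.coeFn_mk]
    constructor
    · intro hz
      exact ⟨_, ⟨z, hz, rfl⟩, by rw [← ha z hz, Fin.cons_self_tail]⟩
    · rintro ⟨_, ⟨w, hw, rfl⟩, rfl⟩
      rwa [← ha w hw, Fin.cons_self_tail]

theorem IsBinary.map_cons {m : ℕ} {a : ℝ} (ha : a = 0 ∨ a = 1) {S : Finset (Fin m → ℝ)}
    (hS : IsBinary S) : IsBinary (S.map ⟨_, Fin.cons_right_injective (α := fun _ => ℝ) a⟩) := by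
  intro z hz i
  obtain ⟨w, hw, rfl⟩ := Finset.mem_map.1 hz
  refine Fin.cases ?_ (fun j => ?_) i
  · simpa using ha
  · simpa using hS w hw j

theorem sInf_le_mu_add_mu (k m : ℕ) (d : Fin (m + 1) → ℝ) {l : ℕ} (hl : l ≤ k) :
    sInf ((fun y : Fin (m + 1) → ℝ => ((∑ j, d j * y j : ℝ) : EReal)) '' Y k (m + 1)) ≤
      mu m d l + ((((k - l : ℕ) : ℝ) * d 0 : ℝ) : EReal) + mu m d (k - l) := by
  classical
  rw [image_Y_eq]
  rcases mu_eq_top_or_attained m d l with h | ⟨S, hSc, hS, h⟩ <;>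
    rcases mu_eq_top_or_attained m d (k - l) with h' | ⟨T, hTc, hT, h'⟩ <;> rw [h, h']
  · rw [EReal.top_add_coe, EReal.top_add_top]
    exact le_top
  · rw [EReal.top_add_coe, EReal.top_add_coe]
    exact le_top
  · rw [← EReal.coe_add, EReal.coe_add_top]
    exact le_top
  · have hd : Disjoint (S.map ⟨_, Fin.cons_right_injective (α := fun _ => ℝ) (0 : ℝ)⟩)
        (T.map ⟨_, Fin.cons_right_injective (α := fun _ => ℝ) (1 : ℝ)⟩) := by
      rw [Finset.disjoint_left]
      intro z hz hz'
      obtain ⟨w, -, rfl⟩ := Finset.mem_map.1 hz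
      obtain ⟨w', -, hw'⟩ := Finset.mem_map.1 hz'
      simpa using congrFun hw' 0
    refine sInf_le ⟨(S.map _).disjUnion (T.map _) hd, ⟨?_, ?_⟩, ?_⟩
    · rw [Finset.card_disjUnion, Finset.card_map, Finset.card_map, hSc, hTc,
        Nat.add_sub_cancel' hl]
    · intro z hz
      rcases Finset.mem_disjUnion.1 hz with hz | hz
      · exact hS.map_cons (Or.inl rfl) z hz
      · exact hT.map_cons (Or.inr rfl) z hz
    · simp only [← EReal.coe_add, EReal.coe_eq_coe_iff]
      rw [totalCost, Finset.sum_disjUnion, ← totalCost, ← totalCost, totalCost_map_cons,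
        totalCost_map_cons, hTc]
      ring

theorem exists_mu_add_mu_le (m : ℕ) (d : Fin (m + 1) → ℝ) {k : ℕ}
    {S : Finset (Fin (m + 1) → ℝ)} (hc : S.card = k) (hS : IsBinary S) :
    ∃ l ≤ k, mu m d l + ((((k - l : ℕ) : ℝ) * d 0 : ℝ) : EReal) + mu m d (k - l) ≤
      (totalCost d S : EReal) := by
  classical
  obtain ⟨T, hT, hST⟩ := exists_map_cons 0 (S.filter fun z => z 0 = 0)
    (fun z hz => hS z (Finset.mem_filter.1 hz).1) (fun z hz => (Finset.mem_filter.1 hz).2)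
  obtain ⟨U, hU, hSU⟩ := exists_map_cons 1 (S.filter fun z => ¬ z 0 = 0)
    (fun z hz => hS z (Finset.mem_filter.1 hz).1)
    (fun z hz => (hS z (Finset.mem_filter.1 hz).1 0).resolve_left (Finset.mem_filter.1 hz).2)
  have hcard := S.card_filter_add_card_filter_not (fun z => z 0 = 0)
  rw [hST, hSU, Finset.card_map, Finset.card_map, hc] at hcard
  have hcost : totalCost d S = totalCost (fun j => d j.succ) T + ((k - T.card : ℕ) : ℝ) * d 0 +
      totalCost (fun j => d j.succ) U := by
    rw [totalCost, ← Finset.sum_filter_add_sum_filter_not S (fun z => z 0 = 0), hST, hSU,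
      ← totalCost, ← totalCost, totalCost_map_cons, totalCost_map_cons,
      show k - T.card = U.card by omega]
    ring
  refine ⟨T.card, by omega, ?_⟩
  rw [hcost, EReal.coe_add, EReal.coe_add]
  gcongr
  · exact mu_le m d rfl hT
  · exact mu_le m d (by omega) hU

/-- Bellman recursion: for `k ≥ 2` and `m + 1 ≥ 2`, the infimum of `d ⋅ y` over
`Y_{k,m+1}` equals the minimum of `μ_k`, `k d_1 + μ_k`, and
`min_{1 ≤ l ≤ k-1} (μ_l + (k - l) d_1 + μ_{k-l})`, with arithmetic in `ℝ ∪ {+∞}`. -/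
theorem dp_recursion (k m : ℕ) (hk : 2 ≤ k) (hm : 1 ≤ m) (d : Fin (m + 1) → ℝ) :
    sInf ((fun y : Fin (m + 1) → ℝ => ((∑ j, d j * y j : ℝ) : EReal)) '' Y k (m + 1)) =
      min (mu m d k)
        (min ((((k : ℝ) * d 0 : ℝ) : EReal) + mu m d k)
          (⨅ l ∈ Finset.Icc 1 (k - 1),
            (mu m d l + ((((k - l : ℕ) : ℝ) * d 0 : ℝ) : EReal) + mu m d (k - l)))) := by
  apply le_antisymm
  · refine le_min ?_ (le_min ?_ (le_iInf₂ fun l hl => ?_))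
    · simpa [mu_zero] using sInf_le_mu_add_mu k m d le_rfl
    · simpa [mu_zero] using sInf_le_mu_add_mu k m d (Nat.zero_le k)
    · exact sInf_le_mu_add_mu k m d (by have := Finset.mem_Icc.1 hl; omega)
  · rw [image_Y_eq]
    refine le_sInf ?_
    rintro _ ⟨S, ⟨hc, hS⟩, rfl⟩
    obtain ⟨l, hl, h⟩ := exists_mu_add_mu_le m d hc hS
    refine le_trans ?_ h
    rcases Nat.eq_zero_or_pos l with rfl | h0
    · exact (min_le_right _ _).trans ((min_le_left _ _).trans (by simp [mu_zero]))
    rcases hl.eq_or_lt with rfl | hlt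
    · exact (min_le_left _ _).trans (by simp [mu_zero])
    · exact (min_le_right _ _).trans ((min_le_right _ _).trans
        (iInf₂_le l (Finset.mem_Icc.2 ⟨h0, by omega⟩)))
end

section
/- Let ā ∈ ℝ^n, let A ∈ ℝ^{n×m} be such that the map z ↦ ā + Az is injective on {0,1}^m, and let 𝒜 := {ā + Az : z ∈ {0,1}^m}. Let 1 ≤ k ≤ 2^m, x ∈ ℝ^n, and b ∈ ℝ. Then σ̄_k(x) ≥ b (where σ̄_k is computed with respect to the scenario set 𝒜) if and only if xᵀ A y + k (x ⋅ ā) ≥ k b for every y ∈ Y_{k,m}. -/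
/-- The vertices of the unit hypercube `[0,1]^m`, as a finset of `ℝ^m`. -/
noncomputable def cube (m : ℕ) : Finset (Fin m → ℝ) :=
  Finset.image (fun f : Fin m → Bool => fun i => if f i then (1 : ℝ) else 0) Finset.univ

/-- `sigma A k x` is the sum of the `k` smallest values of the multiset
`{x ⋅ a : a ∈ A}` (values listed in nondecreasing order, counting multiplicity). -/
noncomputable def sigma {n : ℕ} (A : Finset (Fin n → ℝ)) (k : ℕ) (x : Fin n → ℝ) : ℝ :=
  (((A.val.map (fun a => ∑ i, x i * a i)).sort (· ≤ ·)).take k).sum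

theorem List.sum_take_length_le_sum_of_sublist {l l' : List ℝ} (hl : l.Pairwise (· ≤ ·))
    (h : l'.Sublist l) : (l.take l'.length).sum ≤ l'.sum := by
  induction l' generalizing l with
  | nil => simp
  | cons c t ih =>
    cases l with
    | nil => simp at h
    | cons a l =>
      have hac : a ≤ c := by
        rcases List.mem_cons.1 (h.subset List.mem_cons_self) with rfl | hc
        · exact le_rfl
        · exact (List.pairwise_cons.1 hl).1 c hc
      simpa using add_le_add hac (ih (List.pairwise_cons.1 hl).2 h.tail)

theorem Multiset.sum_take_sort_le_sum {s t : Multiset ℝ} (h : t ≤ s) :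
    ((s.sort (· ≤ ·)).take (card t)).sum ≤ t.sum := by
  have hsub : (t.sort (· ≤ ·)).Sublist (s.sort (· ≤ ·)) :=
    List.sublist_of_subperm_of_pairwise (r := (· ≤ ·))
      (Multiset.coe_le.1 (by simpa only [Multiset.sort_eq] using h))
      (Multiset.pairwise_sort ..) (Multiset.pairwise_sort ..)
  have hsum : (t.sort (· ≤ ·)).sum = t.sum := by
    rw [← Multiset.sum_coe, Multiset.sort_eq]
  simpa only [Multiset.length_sort, hsum] using
    List.sum_take_length_le_sum_of_sublist (Multiset.pairwise_sort ..) hsub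

theorem Finset.exists_subset_card_eq_sum_take_sort {α : Type*} [DecidableEq α] (C : Finset α)
    (f : α → ℝ) {k : ℕ} (hk : k ≤ C.card) :
    ∃ S ⊆ C, S.card = k ∧ ∑ z ∈ S, f z = (((C.val.map f).sort (· ≤ ·)).take k).sum := by
  have hperm : ((C.val.map f).sort (· ≤ ·)).Perm (C.toList.map f) := by
    rw [← Multiset.coe_eq_coe, Multiset.sort_eq, ← Multiset.map_coe, Finset.coe_toList]
  obtain ⟨p, hp, hsub⟩ := (List.take_sublist k _).subperm.trans hperm.subperm
  obtain ⟨l, hl, rfl⟩ := List.sublist_map_iff.1 hsub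
  have hnd : l.Nodup := C.nodup_toList.sublist hl
  refine ⟨l.toFinset, fun z hz => ?_, ?_, ?_⟩
  · simpa using hl.subset (List.mem_toFinset.1 hz)
  · rw [List.toFinset_card_of_nodup hnd]
    simpa [hk] using hp.length_eq
  · rw [List.sum_toFinset f hnd, hp.sum_eq]

theorem mem_cube {m : ℕ} {z : Fin m → ℝ} : z ∈ cube m ↔ ∀ i, z i = 0 ∨ z i = 1 := by
  simp only [cube, Finset.mem_image, Finset.mem_univ, true_and]
  constructor
  · rintro ⟨f, rfl⟩ i
    cases h : f i <;> simp [h]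
  · intro h
    refine ⟨fun i => decide (z i = 1), funext fun i => ?_⟩
    rcases h i with h | h <;> simp [h]

theorem card_cube (m : ℕ) : (cube m).card = 2 ^ m := by
  rw [cube, Finset.card_image_of_injective]
  · simp
  · intro f g h
    funext i
    have := congrFun h i
    cases hf : f i <;> cases hg : g i <;> simp_all

theorem sum_dot_affine {n m : ℕ} (abar : Fin n → ℝ) (A : Matrix (Fin n) (Fin m) ℝ)
    (x : Fin n → ℝ) (S : Finset (Fin m → ℝ)) :
    ∑ z ∈ S, ∑ i, x i * (abar + A.mulVec z) i =
      (∑ i, x i * (A.mulVec (∑ z ∈ S, z)) i) + S.card * ∑ i, x i * abar i := by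
  change ∑ z ∈ S, x ⬝ᵥ (abar + A.mulVec z) =
    x ⬝ᵥ A.mulVec (∑ z ∈ S, z) + S.card * (x ⬝ᵥ abar)
  simp only [dotProduct_add, Finset.sum_add_distrib, Finset.sum_const, nsmul_eq_mul,
    Matrix.mulVec_sum, dotProduct_sum]
  ring

/-- For the scenario set `𝒜 = {ā + Az : z ∈ {0,1}^m}` (with injective affine
parametrization) and `1 ≤ k ≤ 2^m`, the constraint `σ̄_k(x) ≥ b` holds if and only if
`xᵀ A y + k (x ⋅ ā) ≥ k b` for every `y ∈ Y_{k,m}`. -/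
theorem sigmabar_iff_ineqs {n m : ℕ} (abar : Fin n → ℝ) (A : Matrix (Fin n) (Fin m) ℝ)
    (hinj : Set.InjOn (fun z => abar + A.mulVec z)
      {z : Fin m → ℝ | ∀ i, z i = 0 ∨ z i = 1})
    (k : ℕ) (hk : 1 ≤ k) (hk2 : k ≤ 2 ^ m) (x : Fin n → ℝ) (b : ℝ) :
    b ≤ sigma ((cube m).image (fun z => abar + A.mulVec z)) k x / k ↔
      ∀ y ∈ Y k m,
        k * b ≤ (∑ i, x i * (A.mulVec y) i) + k * (∑ i, x i * abar i) := by
  have hkpos : (0 : ℝ) < k := by exact_mod_cast hk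
  have hval : ((cube m).image (fun z => abar + A.mulVec z)).val.map (fun a => ∑ i, x i * a i) =
      (cube m).val.map (fun z => ∑ i, x i * (abar + A.mulVec z) i) := by
    rw [Finset.image_val_of_injOn (hinj.mono fun z hz => mem_cube.1 hz), Multiset.map_map]
    rfl
  rw [le_div_iff₀ hkpos, mul_comm, sigma, hval]
  constructor
  · rintro h y ⟨S, rfl, hS, rfl⟩
    rw [← sum_dot_affine]
    refine h.trans ?_
    have hle := Multiset.sum_take_sort_le_sum (Multiset.map_le_map
      (f := fun z => ∑ i, x i * (abar + A.mulVec z) i)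
      (Finset.val_le_iff.2 fun z hz => mem_cube.2 (hS z hz)))
    rwa [Multiset.card_map] at hle
  · intro h
    obtain ⟨S, hSC, rfl, hsum⟩ := (cube m).exists_subset_card_eq_sum_take_sort
      (fun z => ∑ i, x i * (abar + A.mulVec z) i) (hk2.trans_eq (card_cube m).symm)
    rw [← hsum, sum_dot_affine]
    exact h _ ⟨S, rfl, fun z hz => mem_cube.1 (hSC hz), rfl⟩
end

section
/- Let ā ∈ ℝ^n, let A ∈ ℝ^{n×m} be such that the map z ↦ ā + Az is injective on {0,1}^m, and let 𝒜 := {ā + Az : z ∈ {0,1}^m}. Let 2 ≤ k ≤ 2^m, x ∈ ℝ^n, and b ∈ ℝ. Then v_k(x) ≥ b (where v_k is computed with respect to the scenario set 𝒜) if and only if there exists y ∈ Y_{k−1,m} such that xᵀ A w + (x ⋅ ā) ≥ b + xᵀ A y for every w ∈ Y_{k,m}. -/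
/-- `vk A k x` is the `k`-th smallest value of the multiset `{x ⋅ a : a ∈ A}`
(the entry in position `k` of the nondecreasing list of values). -/
noncomputable def vk {n : ℕ} (A : Finset (Fin n → ℝ)) (k : ℕ) (x : Fin n → ℝ) : ℝ :=
  ((A.val.map (fun a => ∑ i, x i * a i)).sort (· ≤ ·)).getD (k - 1) 0

/-- A finset with more than `j` elements splits around an element `p` in position `j` of the
nondecreasing list of values of `g`. -/
theorem exists_split_at_sorted_index {α : Type*} [DecidableEq α] (C : Finset α) (g : α → ℝ)
    {j : ℕ} (hj : j < C.card) :
    ∃ T ⊆ C, ∃ p ∈ C, p ∉ T ∧ T.card = j ∧ (∀ t ∈ T, g t ≤ g p) ∧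
      (∀ z ∈ C, z ∉ T → g p ≤ g z) ∧
      ((C.val.map g).sort (· ≤ ·)).getD j 0 = g p := by
  classical
  let r : α → α → Prop := fun a b => g a ≤ g b
  have : Std.Total r := ⟨fun a b => le_total _ _⟩
  have : IsTrans α r := ⟨fun a b c => le_trans⟩
  obtain ⟨l, hperm, hsort⟩ : ∃ l : List α, l.Perm C.toList ∧ l.Pairwise r :=
    ⟨_, List.perm_insertionSort r C.toList, List.pairwise_insertionSort r C.toList⟩
  have hnd : l.Nodup := hperm.nodup_iff.2 C.nodup_toList
  have hmem : ∀ z, z ∈ l ↔ z ∈ C := fun z => by rw [hperm.mem_iff, Finset.mem_toList]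
  have hlen : j < l.length := by rw [hperm.length_eq, Finset.length_toList]; exact hj
  have hval : (C.val.map g).sort (· ≤ ·) = l.map g := by
    apply List.Perm.eq_of_pairwise' (r := (· ≤ ·))
    · exact Multiset.pairwise_sort _ _
    · exact List.pairwise_map.2 hsort
    · rw [← Multiset.coe_eq_coe, Multiset.sort_eq, ← Multiset.map_coe,
        Multiset.coe_eq_coe.2 hperm, Finset.coe_toList]
  have hle : ∀ (a b : ℕ) (ha : a < l.length) (hb : b < l.length), a ≤ b → g l[a] ≤ g l[b] := by
    intro a b ha hb hab
    rcases hab.eq_or_lt with rfl | h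
    · exact le_rfl
    · exact List.pairwise_iff_getElem.1 hsort a b ha hb h
  have hT : ∀ z, z ∈ (l.take j).toFinset ↔ ∃ (i : ℕ) (hi : i < l.length), i < j ∧ l[i] = z := by
    intro z
    rw [List.mem_toFinset, List.mem_take_iff_getElem]
    constructor
    · rintro ⟨i, hi, rfl⟩
      exact ⟨i, by omega, by omega, rfl⟩
    · rintro ⟨i, hi, hij, rfl⟩
      exact ⟨i, by omega, rfl⟩
  refine ⟨(l.take j).toFinset, ?_, l[j], (hmem _).1 (List.getElem_mem _), ?_, ?_, ?_, ?_, ?_⟩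
  · intro z hz
    obtain ⟨i, hi, -, rfl⟩ := (hT z).1 hz
    exact (hmem _).1 (List.getElem_mem _)
  · intro h
    obtain ⟨i, hi, hij, he⟩ := (hT _).1 h
    exact hij.ne ((hnd.getElem_inj_iff).1 he)
  · rw [List.toFinset_card_of_nodup (hnd.sublist (List.take_sublist _ _)), List.length_take]
    omega
  · intro t ht
    obtain ⟨i, hi, hij, rfl⟩ := (hT t).1 ht
    exact hle _ _ _ _ hij.le
  · intro z hz hzT
    obtain ⟨i, hi, rfl⟩ := List.getElem_of_mem ((hmem z).2 hz)
    refine hle _ _ _ _ (not_lt.1 fun hij => hzT ((hT _).2 ⟨i, hi, hij, rfl⟩))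
  · rw [hval]
    simp [List.getD_eq_getElem?_getD, hlen]

/-- If `f` is at most `v` on `T` and at least `v` on `W \ T`, where `W` has one more element than
`T`, then the sum of `f` over `W` is at least `v` plus its sum over `T`. -/
theorem sum_add_le_sum_of_split {α : Type*} [DecidableEq α] {f : α → ℝ} {v : ℝ}
    {T W : Finset α} (hcard : W.card = T.card + 1) (hT : ∀ t ∈ T, f t ≤ v)
    (hW : ∀ w ∈ W, w ∉ T → v ≤ f w) : v + ∑ t ∈ T, f t ≤ ∑ w ∈ W, f w := by
  have h1 : ((W \ T).card : ℝ) * v ≤ ∑ w ∈ W \ T, f w := by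
    rw [← nsmul_eq_mul]
    refine Finset.card_nsmul_le_sum _ _ _ fun w hw => ?_
    rw [Finset.mem_sdiff] at hw
    exact hW w hw.1 hw.2
  have h2 : ∑ t ∈ T \ W, f t ≤ ((T \ W).card : ℝ) * v := by
    rw [← nsmul_eq_mul]
    exact Finset.sum_le_card_nsmul _ _ _ fun t ht => hT t (Finset.mem_sdiff.1 ht).1
  have h3 : ((W \ T).card : ℝ) = (T \ W).card + 1 := by
    have hw := Finset.card_sdiff_add_card_inter W T
    have ht := Finset.card_sdiff_add_card_inter T W
    rw [Finset.inter_comm] at ht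
    norm_cast
    omega
  have h4 := Finset.sum_sdiff_sub_sum_sdiff (s₁ := T) (s₂ := W) (f := f)
  rw [h3] at h1
  linarith

/-- For the scenario set `𝒜 = {ā + Az : z ∈ {0,1}^m}` (with injective affine
parametrization) and `2 ≤ k ≤ 2^m`, the constraint `v_k(x) ≥ b` holds if and only if
there exists `y ∈ Y_{k−1,m}` with `xᵀ A w + x ⋅ ā ≥ b + xᵀ A y` for every `w ∈ Y_{k,m}`. -/
theorem vk_iff_exists_y {n m : ℕ} (abar : Fin n → ℝ) (A : Matrix (Fin n) (Fin m) ℝ)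
    (hinj : Set.InjOn (fun z => abar + A.mulVec z)
      {z : Fin m → ℝ | ∀ i, z i = 0 ∨ z i = 1})
    (k : ℕ) (hk : 2 ≤ k) (hk2 : k ≤ 2 ^ m) (x : Fin n → ℝ) (b : ℝ) :
    b ≤ vk ((cube m).image (fun z => abar + A.mulVec z)) k x ↔
      ∃ y ∈ Y (k - 1) m, ∀ w ∈ Y k m,
        b + (∑ i, x i * (A.mulVec y) i) ≤
          (∑ i, x i * (A.mulVec w) i) + (∑ i, x i * abar i) := by
  classical
  obtain ⟨j, rfl⟩ : ∃ j, k = j + 1 := ⟨k - 1, by omega⟩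
  let f : (Fin m → ℝ) → ℝ := fun z => x ⬝ᵥ A.mulVec z
  let c : ℝ := ∑ i, x i * abar i
  have hfsum : ∀ S : Finset (Fin m → ℝ), ∑ i, x i * (A.mulVec (∑ z ∈ S, z)) i = ∑ z ∈ S, f z := by
    intro S
    change x ⬝ᵥ A.mulVec (∑ z ∈ S, z) = _
    rw [Matrix.mulVec_sum, dotProduct_sum]
  obtain ⟨T, hTC, p, hpC, hpT, hTcard, hTp, hpz, hsort⟩ :=
    exists_split_at_sorted_index (cube m) (fun z => f z + c) (j := j) (by rw [card_cube]; omega)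
  simp only [add_le_add_iff_right] at hTp hpz
  have hvk : vk ((cube m).image (fun z => abar + A.mulVec z)) (j + 1) x = f p + c := by
    rw [← hsort, vk, Finset.image_val_of_injOn, Multiset.map_map, Nat.add_sub_cancel]
    · congr 3
      funext z
      simp [f, c, dotProduct, mul_add, Finset.sum_add_distrib, add_comm]
    · exact hinj.mono fun z hz => mem_cube.1 hz
  rw [hvk, Nat.add_sub_cancel]
  constructor
  · intro hb
    refine ⟨_, ⟨T, hTcard, fun z hz => mem_cube.1 (hTC hz), rfl⟩, ?_⟩
    rintro _ ⟨W, hWcard, hW, rfl⟩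
    rw [hfsum, hfsum]
    have := sum_add_le_sum_of_split (f := f) (T := T) (W := W) (hTcard ▸ hWcard) hTp
      fun w hw hwT => hpz w (mem_cube.2 (hW w hw)) hwT
    change _ ≤ _ + c
    linarith
  · rintro ⟨_, ⟨S, hScard, hS, rfl⟩, h⟩
    obtain ⟨z, hz, hzS⟩ : ∃ z ∈ insert p T, z ∉ S :=
      Finset.exists_mem_notMem_of_card_lt_card
        (by rw [Finset.card_insert_of_notMem hpT]; omega)
    have hzp : f z ≤ f p := by
      rcases Finset.mem_insert.1 hz with rfl | hz
      · exact le_rfl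
      · exact hTp z hz
    have hzC : z ∈ cube m := Finset.insert_subset hpC hTC hz
    have hw := h _ ⟨insert z S, by rw [Finset.card_insert_of_notMem hzS, hScard],
      fun u hu => (Finset.mem_insert.1 hu).elim (fun e => e ▸ mem_cube.1 hzC) (hS u), rfl⟩
    rw [hfsum, hfsum, Finset.sum_insert hzS] at hw
    change _ ≤ _ + c at hw
    linarith
end
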